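/- arXiv:1611.05819 — 5 statements merged into one kernel-verified Lean document; each statement's English description precedes it below -/
import Mathlib

section
/- The sequence (p_k)_{k≥1} is strictly increasing in k and converges to 1 as k → ∞; equivalently, the sequence (q_k)_{k≥1} with q_k = 1/p_k is strictly decreasing and converges to 1. -/
theorem strictMonoOn_of_pow_eq_one_sub {p : ℕ → ℝ}
    (hp : ∀ k, 1 ≤ k → p k ∈ Set.Ioo (0 : ℝ) 1 ∧ p k ^ k = 1 - p k) :
    StrictMonoOn p (Set.Ici 1) := by
  intro j hj k hk hjk
  obtain ⟨⟨hj0, hj1⟩, hje⟩ := hp j hj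
  obtain ⟨⟨hk0, -⟩, hke⟩ := hp k hk
  by_contra! h
  have h1 : p k ^ k ≤ p j ^ k := pow_le_pow_left₀ hk0.le h k
  have h2 : p j ^ k < p j ^ j := pow_lt_pow_right_of_lt_one₀ hj0 hj1 hjk
  linarith

theorem tendsto_one_of_pow_eq_one_sub {p : ℕ → ℝ}
    (hp : ∀ k, 1 ≤ k → p k ∈ Set.Ioo (0 : ℝ) 1 ∧ p k ^ k = 1 - p k) :
    Filter.Tendsto p Filter.atTop (nhds 1) := by
  refine tendsto_order.2 ⟨fun a ha => ?_, fun b hb => ?_⟩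
  · rcases lt_or_ge a 0 with h0 | h0
    · filter_upwards [Filter.eventually_ge_atTop 1] with k hk
      exact h0.trans (hp k hk).1.1
    · filter_upwards [Filter.eventually_ge_atTop 1,
        (tendsto_pow_atTop_nhds_zero_of_lt_one h0 ha).eventually_lt_const (sub_pos.2 ha)]
        with k hk hak
      obtain ⟨⟨hk0, -⟩, hke⟩ := hp k hk
      by_contra! h
      have h1 : p k ^ k ≤ a ^ k := pow_le_pow_left₀ hk0.le h k
      linarith
  · filter_upwards [Filter.eventually_ge_atTop 1] with k hk
    exact (hp k hk).1.2.trans hb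

/-- The sequence `(p_k)_{k ≥ 1}` is strictly increasing and converges to `1`;
equivalently `(q_k)_{k ≥ 1}` with `q_k = 1/p_k` is strictly decreasing and converges to `1`. -/
theorem stmt_2 (p : ℕ → ℝ)
    (hp : ∀ k, 1 ≤ k → p k ∈ Set.Ioo (0 : ℝ) 1 ∧ p k ^ k = 1 - p k) :
    StrictMonoOn p (Set.Ici 1) ∧
    Filter.Tendsto p Filter.atTop (nhds 1) ∧
    StrictAntiOn (fun k => 1 / p k) (Set.Ici 1) ∧
    Filter.Tendsto (fun k => 1 / p k) Filter.atTop (nhds 1) := by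
  have hmono := strictMonoOn_of_pow_eq_one_sub hp
  have hlim := tendsto_one_of_pow_eq_one_sub hp
  refine ⟨hmono, hlim, fun j hj k hk hjk => ?_, ?_⟩
  · exact one_div_lt_one_div_of_lt (hp j hj).1.1 (hmono hj hk hjk)
  · simpa using hlim.inv₀ one_ne_zero
end

section
/- For every integer k ≥ 1 and every n ∈ ℕ, the number s_k^n of binary strings of k-length n satisfies s_k^n ≤ q_k^n. -/
/-- The `k`-length of a finite binary string: `ℓ_k(σ) = #₀(σ) + k·#₁(σ)`. -/
def klen (k : ℕ) (σ : List Bool) : ℕ := σ.count false + k * σ.count true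

/-- `s_k^n`: the number of binary strings of `k`-length exactly `n`. -/
noncomputable def skn (k n : ℕ) : ℕ := Set.ncard {σ : List Bool | klen k σ = n}

theorem klen_nil (k : ℕ) : klen k [] = 0 := by simp [klen]

theorem klen_cons_false (k : ℕ) (σ : List Bool) : klen k (false :: σ) = klen k σ + 1 := by
  simp [klen]; ring

theorem klen_cons_true (k : ℕ) (σ : List Bool) : klen k (true :: σ) = klen k σ + k := by
  simp [klen]; ring

theorem skn_zero {k : ℕ} (hk : 1 ≤ k) : skn k 0 = 1 := by
  have h : {σ : List Bool | klen k σ = 0} = {[]} := by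
    ext σ
    rcases σ with _ | ⟨_ | _, σ⟩
    · simp [klen_nil]
    · simp [klen_cons_false]
    · simp only [Set.mem_ofPred_eq, klen_cons_true, Set.mem_singleton_iff, reduceCtorEq, iff_false]
      omega
  rw [skn, h, Set.ncard_singleton]

theorem skn_succ_of_lt {k n : ℕ} (h : n + 1 < k) : skn k (n + 1) = skn k n := by
  have hs : {σ : List Bool | klen k σ = n + 1} = List.cons false '' {σ | klen k σ = n} := by
    ext σ
    rcases σ with _ | ⟨_ | _, σ⟩
    · simp [klen_nil]
    · simp [klen_cons_false]
    · simp [klen_cons_true]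
      omega
  rw [skn, hs, Set.ncard_image_of_injective _ List.cons_injective, skn]

theorem skn_succ_le {k n m : ℕ} (h : m + k = n + 1) :
    skn k (n + 1) ≤ skn k n + skn k m := by
  have hs : {σ : List Bool | klen k σ = n + 1} =
      List.cons false '' {σ | klen k σ = n} ∪ List.cons true '' {σ | klen k σ = m} := by
    ext σ
    rcases σ with _ | ⟨_ | _, σ⟩
    · simp [klen_nil]
    · simp [klen_cons_false]
    · simp [klen_cons_true]
      omega
  rw [skn, hs]
  refine (Set.ncard_union_le _ _).trans_eq ?_
  rw [Set.ncard_image_of_injective _ List.cons_injective,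
    Set.ncard_image_of_injective _ List.cons_injective, skn, skn]

theorem skn_mul_pow_le_one {k : ℕ} (hk : 1 ≤ k) {p : ℝ} (hp0 : 0 ≤ p) (hp1 : p ≤ 1)
    (hpk : p ^ k = 1 - p) (n : ℕ) : (skn k n : ℝ) * p ^ n ≤ 1 := by
  induction n using Nat.strong_induction_on with
  | _ n ih =>
    rcases n with _ | n
    · simp [skn_zero hk]
    · have hn := ih n (Nat.lt_succ_self n)
      rcases lt_or_ge (n + 1) k with h | h
      · rw [skn_succ_of_lt h, pow_succ, ← mul_assoc]
        exact mul_le_one₀ hn hp0 hp1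
      · obtain ⟨m, hm⟩ := Nat.exists_eq_add_of_le' h
        have hle : (skn k (n + 1) : ℝ) ≤ skn k n + skn k m := by
          exact_mod_cast skn_succ_le hm.symm
        calc (skn k (n + 1) : ℝ) * p ^ (n + 1)
            ≤ (skn k n + skn k m) * p ^ (n + 1) := by gcongr
          _ = skn k n * p ^ n * p + skn k m * p ^ m * p ^ k := by
            rw [add_mul, mul_assoc _ (p ^ n), ← pow_succ, mul_assoc _ (p ^ m), ← pow_add, ← hm]
          _ ≤ 1 * p + 1 * p ^ k := by
            gcongr
            exact ih m (by omega)
          _ = 1 := by rw [hpk]; ring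

/-- For `k ≥ 1` and every `n`, `s_k^n ≤ q_k^n` where `q_k = 1/p_k`. -/
theorem stmt_9 (k : ℕ) (hk : 1 ≤ k) (p : ℝ) (hp : p ∈ Set.Ioo (0 : ℝ) 1)
    (hpk : p ^ k = 1 - p) (n : ℕ) :
    (skn k n : ℝ) ≤ (1 / p) ^ n := by
  rw [one_div_pow, le_div_iff₀ (pow_pos hp.1 n)]
  exact skn_mul_pow_le_one hk hp.1.le hp.2.le hpk n
end

section
/- Let k ≥ 1 be an integer and let (r_i)_{i∈ℕ} be a sequence of natural numbers with Σ_{i∈ℕ} q_k^{-r_i} ≤ q_k^{-k}. Then there exists a sequence (σ_i)_{i∈ℕ} of finite binary strings such that ℓ_k(σ_i) = r_i for every i, and for all i ≠ j the string σ_i is not a prefix of σ_j (so {σ_i : i ∈ ℕ} is prefix-free). -/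
theorem klen_append (k : ℕ) (σ τ : List Bool) : klen k (σ ++ τ) = klen k σ + klen k τ := by
  simp only [klen, List.count_append]
  ring

theorem length_le_klen {k : ℕ} (hk : 1 ≤ k) (σ : List Bool) : σ.length ≤ klen k σ := by
  induction σ with
  | nil => simp
  | cons b σ ih =>
    cases b
    · rw [klen_cons_false, List.length_cons]; omega
    · rw [klen_cons_true, List.length_cons]; omega

theorem eq_of_isPrefix_of_klen_le {k : ℕ} (hk : 1 ≤ k) {σ τ : List Bool} (h : σ <+: τ)
    (hle : klen k τ ≤ klen k σ) : σ = τ := by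
  obtain ⟨ρ, rfl⟩ := h
  rw [klen_append] at hle
  have hρ := length_le_klen hk ρ
  rw [List.eq_nil_of_length_eq_zero (l := ρ) (by omega), List.append_nil]

theorem finite_setOf_klen_eq {k : ℕ} (hk : 1 ≤ k) (n : ℕ) :
    {σ : List Bool | klen k σ = n}.Finite :=
  (List.finite_length_le Bool n).subset fun σ hσ => (length_le_klen hk σ).trans_eq hσ

/-- The number of binary strings of `k`-length `n`. -/
noncomputable def klenCount (k n : ℕ) : ℕ := {σ : List Bool | klen k σ = n}.ncard

theorem klenCount_zero {k : ℕ} (hk : 1 ≤ k) : klenCount k 0 = 1 := by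
  rw [klenCount, Set.ncard_eq_one]
  refine ⟨[], Set.ext fun σ => ⟨fun hσ => ?_, ?_⟩⟩
  · exact List.eq_nil_of_length_eq_zero (Nat.le_zero.1 ((length_le_klen hk σ).trans_eq hσ))
  · rintro rfl
    simp [klen]

theorem klenCount_succ_of_lt {k n : ℕ} (h : n + 1 < k) :
    klenCount k (n + 1) = klenCount k n := by
  have : {σ : List Bool | klen k σ = n + 1} = List.cons false '' {σ | klen k σ = n} := by
    ext σ
    rcases σ with _ | ⟨_ | _, σ⟩
    · simp [klen]
    · simp [klen_cons_false]
    · simp [klen_cons_true]; omega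
  rw [klenCount, this, Set.ncard_image_of_injective _ (List.cons_injective), klenCount]

theorem klenCount_succ_of_le {k n : ℕ} (hk : 1 ≤ k) (h : k ≤ n + 1) :
    klenCount k (n + 1) = klenCount k n + klenCount k (n + 1 - k) := by
  have : {σ : List Bool | klen k σ = n + 1} =
      List.cons false '' {σ | klen k σ = n} ∪ List.cons true '' {σ | klen k σ = n + 1 - k} := by
    ext σ
    rcases σ with _ | ⟨_ | _, σ⟩
    · simp [klen]
    · simp [klen_cons_false]
    · simp [klen_cons_true]; omega
  rw [klenCount, this, Set.ncard_union_eq ?_ ((finite_setOf_klen_eq hk _).image _)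
      ((finite_setOf_klen_eq hk _).image _), Set.ncard_image_of_injective _ List.cons_injective,
    Set.ncard_image_of_injective _ List.cons_injective, klenCount, klenCount]
  rw [Set.disjoint_left]
  rintro _ ⟨σ, -, rfl⟩ ⟨τ, -, h⟩
  simp at h

theorem klenCount_succ_mul_pow {k n : ℕ} (hk : 1 ≤ k) (h : k ≤ n + 1) (p : ℝ) :
    klenCount k (n + 1) * p ^ (n + 1) =
      p * (klenCount k n * p ^ n) + p ^ k * (klenCount k (n + 1 - k) * p ^ (n + 1 - k)) := by
  have hpow : p ^ (n + 1) = p ^ k * p ^ (n + 1 - k) := by rw [← pow_add]; congr 1; omega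
  rw [klenCount_succ_of_le hk h]
  push_cast
  rw [add_mul]
  nth_rw 2 [hpow]
  ring

theorem klenCount_mul_pow_le_one {k : ℕ} (hk : 1 ≤ k) {p : ℝ} (hp : p ∈ Set.Ioo (0 : ℝ) 1)
    (hpk : p ^ k = 1 - p) (n : ℕ) : klenCount k n * p ^ n ≤ 1 := by
  induction n using Nat.strong_induction_on with
  | _ n ih =>
    rcases n with _ | n
    · simp [klenCount_zero hk]
    · have h₁ := ih n (by omega)
      rcases lt_or_ge (n + 1) k with h | h
      · rw [klenCount_succ_of_lt h, pow_succ, ← mul_assoc]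
        exact mul_le_one₀ h₁ hp.1.le hp.2.le
      · have h₂ := ih (n + 1 - k) (by omega)
        rw [klenCount_succ_mul_pow hk h, hpk]
        nlinarith [hp.1, hp.2]

theorem klenCount_of_lt {k n : ℕ} (h : n < k) : klenCount k n = 1 := by
  induction n with
  | zero => exact klenCount_zero h
  | succ n ih => rw [klenCount_succ_of_lt h, ih (by omega)]

theorem pow_le_klenCount_mul_pow {k : ℕ} (hk : 1 ≤ k) {p : ℝ} (hp : p ∈ Set.Ioo (0 : ℝ) 1)
    (hpk : p ^ k = 1 - p) (n : ℕ) : p ^ k ≤ klenCount k n * p ^ n := by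
  induction n using Nat.strong_induction_on with
  | _ n ih =>
    rcases lt_or_ge n k with h | h
    · rw [klenCount_of_lt h, Nat.cast_one, one_mul]
      exact pow_le_pow_of_le_one hp.1.le hp.2.le h.le
    · obtain ⟨n, rfl⟩ : ∃ m, n = m + 1 := ⟨n - 1, by omega⟩
      have h₁ := ih n (by omega)
      have h₂ := ih (n + 1 - k) (by omega)
      rw [klenCount_succ_mul_pow hk h]
      rw [hpk] at h₁ h₂ ⊢
      nlinarith [hp.1, hp.2]

theorem ncard_setOf_isPrefix_le {k : ℕ} (hk : 1 ≤ k) (τ : List Bool) (n : ℕ) :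
    {σ | klen k σ = n ∧ τ <+: σ}.ncard ≤ klenCount k (n - klen k τ) := by
  have hsub : {σ | klen k σ = n ∧ τ <+: σ} ⊆ (τ ++ ·) '' {ρ | klen k ρ = n - klen k τ} := by
    rintro _ ⟨h, ρ, rfl⟩
    refine ⟨ρ, ?_, rfl⟩
    rw [klen_append] at h
    exact (Nat.sub_eq_of_eq_add' h.symm).symm
  exact (Set.ncard_le_ncard hsub ((finite_setOf_klen_eq hk _).image _)).trans
    (Set.ncard_image_le (finite_setOf_klen_eq hk _))

/-- A string of `k`-length `n` avoiding finitely many shorter strings of small total weight. -/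
theorem exists_klen_eq_forall_not_isPrefix {k : ℕ} (hk : 1 ≤ k) {p : ℝ}
    (hp : p ∈ Set.Ioo (0 : ℝ) 1) (hpk : p ^ k = 1 - p) {ι : Type*} (s : Finset ι)
    (g : ι → List Bool) (n : ℕ) (hle : ∀ j ∈ s, klen k (g j) ≤ n)
    (hsum : ∑ j ∈ s, p ^ klen k (g j) < p ^ k) :
    ∃ σ, klen k σ = n ∧ ∀ j ∈ s, ¬ g j <+: σ := by
  by_contra! hcon
  have hsub : {σ | klen k σ = n} ⊆ ⋃ j ∈ s, {σ | klen k σ = n ∧ g j <+: σ} := by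
    intro σ hσ
    obtain ⟨j, hj, hpre⟩ := hcon σ hσ
    exact Set.mem_biUnion (Finset.mem_coe.2 hj) ⟨hσ, hpre⟩
  have hcard : klenCount k n ≤ ∑ j ∈ s, klenCount k (n - klen k (g j)) :=
    (Set.ncard_le_ncard hsub (s.finite_toSet.biUnion fun j _ =>
      (finite_setOf_klen_eq hk n).subset fun _ h => h.1)).trans <|
    (Finset.set_ncard_biUnion_le s _).trans <|
    Finset.sum_le_sum fun j _ => ncard_setOf_isPrefix_le hk (g j) n
  refine hsum.not_ge ?_
  calc p ^ k ≤ klenCount k n * p ^ n := pow_le_klenCount_mul_pow hk hp hpk n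
    _ ≤ (∑ j ∈ s, (klenCount k (n - klen k (g j)) : ℝ)) * p ^ n :=
      mul_le_mul_of_nonneg_right (by exact_mod_cast hcard) (pow_nonneg hp.1.le n)
    _ = ∑ j ∈ s, klenCount k (n - klen k (g j)) * p ^ (n - klen k (g j)) * p ^ klen k (g j) := by
      rw [Finset.sum_mul]
      refine Finset.sum_congr rfl fun j hj => ?_
      rw [mul_assoc, ← pow_add, Nat.sub_add_cancel (hle j hj)]
    _ ≤ ∑ j ∈ s, p ^ klen k (g j) := Finset.sum_le_sum fun j _ =>
      mul_le_of_le_one_left (pow_nonneg hp.1.le _) (klenCount_mul_pow_le_one hk hp hpk _)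

/-- Given requests `(r_i)` with `Σ_i q_k^{-r_i} ≤ q_k^{-k}`, there is a prefix-free
sequence of strings `(σ_i)` with `ℓ_k(σ_i) = r_i` for all `i`. -/
theorem stmt_12 (k : ℕ) (hk : 1 ≤ k) (p : ℝ) (hp : p ∈ Set.Ioo (0 : ℝ) 1)
    (hpk : p ^ k = 1 - p) (r : ℕ → ℕ)
    (hsum : Summable fun i => (1 / p) ^ (-(r i : ℤ)))
    (hbd : ∑' i, (1 / p) ^ (-(r i : ℤ)) ≤ (1 / p) ^ (-(k : ℤ))) :
    ∃ σ : ℕ → List Bool, (∀ i, klen k (σ i) = r i) ∧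
      ∀ i j, i ≠ j → ¬ (σ i <+: σ j) := by
  classical
  have hpow (m : ℕ) : (1 / p) ^ (-(m : ℤ)) = p ^ m := by simp
  simp only [hpow] at hsum hbd
  let key : ℕ → ℕ ×ₗ ℕ := fun i => toLex (r i, i)
  have hkey {i j : ℕ} (h : key j < key i) : r j ≤ r i := by
    rcases Prod.Lex.toLex_lt_toLex.1 h with h | h
    · exact h.le
    · exact h.1.le
  have wf : WellFounded fun j i => key j < key i := InvImage.wf key wellFounded_lt
  have hfin (i : ℕ) : {j | key j < key i}.Finite := by
    have h := hsum.tendsto_cofinite_zero.eventually_lt_const (pow_pos hp.1 (r i))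
    refine (Filter.eventually_cofinite.1 h).subset fun j hj => ?_
    exact not_lt.2 (pow_le_pow_of_le_one hp.1.le hp.2.le (hkey hj))
  have step (i : ℕ) (f : ∀ j, key j < key i → {σ : List Bool // klen k σ = r j}) :
      ∃ σ : {σ : List Bool // klen k σ = r i}, ∀ j (h : key j < key i),
        ¬ (f j h).1 <+: σ.1 := by
    let s := (hfin i).toFinset
    let g : ℕ → List Bool := fun j => if h : key j < key i then (f j h).1 else []
    have hg (j : ℕ) (h : key j < key i) : g j = (f j h).1 := dif_pos h
    have hs {j : ℕ} : j ∈ s ↔ key j < key i := (hfin i).mem_toFinset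
    have hgr (j : ℕ) (hj : j ∈ s) : klen k (g j) = r j := by
      rw [hg j (hs.1 hj)]
      exact (f j _).2
    have hi : i ∉ s := fun h => lt_irrefl _ (hs.1 h)
    have hlt : ∑ j ∈ s, p ^ klen k (g j) < p ^ k := by
      rw [Finset.sum_congr rfl fun j hj => by rw [hgr j hj]]
      have h := hsum.sum_le_tsum (insert i s) fun j _ => pow_nonneg hp.1.le (r j)
      rw [Finset.sum_insert hi] at h
      linarith [pow_pos hp.1 (r i)]
    obtain ⟨σ, hσ, hσs⟩ := exists_klen_eq_forall_not_isPrefix hk hp hpk s g (r i)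
      (fun j hj => (hgr j hj).trans_le (hkey (hs.1 hj))) hlt
    exact ⟨⟨σ, hσ⟩, fun j h => hg j h ▸ hσs j (hs.2 h)⟩
  choose F hF using step
  let σ : ∀ i, {σ : List Bool // klen k σ = r i} := wf.fix F
  have hσ {i j : ℕ} (h : key j < key i) : ¬ (σ j).1 <+: (σ i).1 := by
    have := hF i (fun j _ => σ j) j h
    rwa [← wf.fix_eq F i] at this
  refine ⟨fun i => (σ i).1, fun i => (σ i).2, fun i j hij hpre => ?_⟩
  have hne : key i ≠ key j := fun h => hij (congrArg (fun x => (ofLex x).2) h)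
  rcases hne.lt_or_gt with h | h
  · exact hσ h hpre
  · have heq : (σ i).1 = (σ j).1 :=
      eq_of_isPrefix_of_klen_le hk hpre (by rw [(σ i).2, (σ j).2]; exact hkey h)
    exact hσ h (heq ▸ List.prefix_rfl)
end

section
/- Let j, k ≥ 1 be integers, let n ∈ ℕ, let D be a set of finite binary strings, and let F : D → strings be a function. Define S = { σ : there exists τ ∈ D with F(τ) = σ and ℓ_k(τ) < (log q_j / log q_k)·(ℓ_j(σ) - n) }. Then Σ_{σ∈S} q_j^{-ℓ_j(σ)} ≤ q_j^{-n} · Σ_{τ∈D} q_k^{-ℓ_k(τ)} (as sums of nonnegative reals, the left-hand sum being finite whenever the right-hand one is). -/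
/-- Comparison of powers of two numbers in `(0, 1)` from the comparison of the exponents weighted by
the logarithms. -/
theorem pow_le_pow_mul_pow_of_lt_log_div_log {p q : ℝ} (hp : p ∈ Set.Ioo (0 : ℝ) 1)
    (hq : q ∈ Set.Ioo (0 : ℝ) 1) {a b n : ℕ}
    (h : (b : ℝ) < (Real.log (1 / p) / Real.log (1 / q)) * ((a : ℝ) - n)) :
    p ^ a ≤ p ^ n * q ^ b := by
  have hlog : Real.log q < 0 := Real.log_neg hq.1 hq.2
  have hp0 := hp.1
  have hq0 := hq.1
  rw [one_div, one_div, Real.log_inv, Real.log_inv, div_mul_eq_mul_div,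
    lt_div_iff₀ (neg_pos.mpr hlog)] at h
  rw [← Real.log_le_log_iff (by positivity) (by positivity),
    Real.log_mul (by positivity) (by positivity), Real.log_pow, Real.log_pow, Real.log_pow]
  linarith

/-- Let `S = {σ : ∃ τ ∈ D, F τ = σ ∧ ℓ_k(τ) < (log q_j / log q_k)·(ℓ_j(σ) - n)}`.
Then `Σ_{σ ∈ S} q_j^{-ℓ_j(σ)} ≤ q_j^{-n} · Σ_{τ ∈ D} q_k^{-ℓ_k(τ)}`
(as sums of nonnegative extended reals). -/
theorem stmt_15 (j k : ℕ) (hj : 1 ≤ j) (hk : 1 ≤ k) (n : ℕ)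
    (pj pk : ℝ) (hpj : pj ∈ Set.Ioo (0 : ℝ) 1) (hpjj : pj ^ j = 1 - pj)
    (hpk : pk ∈ Set.Ioo (0 : ℝ) 1) (hpkk : pk ^ k = 1 - pk)
    (D : Set (List Bool)) (F : List Bool → List Bool) :
    ∑' σ : {σ : List Bool | ∃ τ ∈ D, F τ = σ ∧
        (klen k τ : ℝ) <
          (Real.log (1 / pj) / Real.log (1 / pk)) * ((klen j σ : ℝ) - n)},
      ENNReal.ofReal ((1 / pj) ^ (-(klen j (σ : List Bool) : ℤ)))
    ≤ ENNReal.ofReal ((1 / pj) ^ (-(n : ℤ))) *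
        ∑' τ : D, ENNReal.ofReal ((1 / pk) ^ (-(klen k (τ : List Bool) : ℤ))) := by
  simp only [one_div, zpow_neg, zpow_natCast, inv_pow, inv_inv]
  rw [← ENNReal.tsum_mul_left]
  choose g hgD hgF hg using fun σ : {σ : List Bool | ∃ τ ∈ D, F τ = σ ∧
    (klen k τ : ℝ) <
      (Real.log (1 / pj) / Real.log (1 / pk)) * ((klen j σ : ℝ) - n)} => σ.2
  have hinj : Function.Injective fun σ => (⟨g σ, hgD σ⟩ : D) := fun σ σ' h =>
    Subtype.ext <| by rw [← hgF σ, ← hgF σ', Subtype.mk.inj h]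
  have hle := ENNReal.tsum_comp_le_tsum_of_injective hinj fun τ : D =>
    ENNReal.ofReal (pj ^ n) * ENNReal.ofReal (pk ^ klen k (τ : List Bool))
  refine le_trans ?_ hle
  refine ENNReal.tsum_le_tsum fun σ => ?_
  rw [← ENNReal.ofReal_mul (pow_nonneg hpj.1.le n)]
  exact ENNReal.ofReal_le_ofReal (pow_le_pow_mul_pow_of_lt_log_div_log hpj hpk (hg σ))
end

section
/- For every integer k ≥ 1 there exists a function ρ from the positive integers to finite binary strings such that the set {ρ(n) : n ≥ 1} is prefix-free (for all m ≠ n, ρ(m) is not a prefix of ρ(n)) and ℓ_k(ρ(n)) ≤ (k+1)·⌊log₂ n⌋ + 2k + 1 for every n ≥ 1. -/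
/-- The `k`-length of a string is at most `k` times its length when `k ≥ 1`. -/
lemma klen_le_mul_length {k : ℕ} (hk : 1 ≤ k) (σ : List Bool) : klen k σ ≤ k * σ.length := by
  have h : σ.count false + σ.count true = σ.length := by
    exact List.count_not_add_count σ true
  rw [klen, ← h, mul_add]
  nlinarith [Nat.le_mul_of_pos_left (σ.count false) hk]

/-- Unary headers of the form `0ᵃ1` can be read off a string unambiguously. -/
lemma eq_and_prefix_of_replicate_false_prefix {a b : ℕ} {x y : List Bool}
    (h : List.replicate a false ++ true :: x <+: List.replicate b false ++ true :: y) :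
    a = b ∧ x <+: y := by
  induction a generalizing b with
  | zero => cases b <;> simp_all [List.replicate_succ]
  | succ a ih =>
    cases b with
    | zero => simp [List.replicate_succ] at h
    | succ b =>
      simp only [List.replicate_succ, List.cons_append, List.cons_prefix_cons, true_and] at h
      obtain ⟨rfl, hxy⟩ := ih h
      exact ⟨rfl, hxy⟩

lemma length_bits {n : ℕ} (hn : 1 ≤ n) : n.bits.length = Nat.log 2 n + 1 := by
  rw [← Nat.length_digits 2 n (by norm_num) (by lia), Nat.digits_two_eq_bits, List.length_map]

lemma bits_injective : Function.Injective Nat.bits := fun m n h => by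
  rw [← Nat.ofDigits_digits 2 m, ← Nat.ofDigits_digits 2 n, Nat.digits_two_eq_bits,
    Nat.digits_two_eq_bits, h]

/-- For every `k ≥ 1` there is a prefix-free encoding `ρ` of the positive integers
with `ℓ_k(ρ(n)) ≤ (k+1)·⌊log₂ n⌋ + 2k + 1` for every `n ≥ 1`. -/
theorem stmt_17 (k : ℕ) (hk : 1 ≤ k) :
    ∃ ρ : ℕ → List Bool,
      (∀ m n : ℕ, 1 ≤ m → 1 ≤ n → m ≠ n → ¬ (ρ m <+: ρ n)) ∧
      ∀ n : ℕ, 1 ≤ n → klen k (ρ n) ≤ (k + 1) * Nat.log 2 n + 2 * k + 1 := by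
  refine ⟨fun n => List.replicate (Nat.log 2 n) false ++ true :: n.bits, ?_, ?_⟩
  · intro m n hm hn hmn h
    obtain ⟨hlog, hbits⟩ := eq_and_prefix_of_replicate_false_prefix h
    refine hmn (bits_injective (hbits.eq_of_length ?_))
    rw [length_bits hm, length_bits hn, hlog]
  · intro n hn
    have hb := klen_le_mul_length hk n.bits
    rw [length_bits hn] at hb
    simp [klen, List.count_replicate] at hb ⊢
    linarith
end
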